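/- For every k ≥ 2, the sphere S^{2k-1} cannot be covered by 2k+1 open sets, none containing a pair of antipodal points, such that every point of the sphere is contained in at most k+1 of the sets. -/

import Mathlib

namespace BorsukUlam

/-- Ordered simplicial chains modulo two, augmented by the empty simplex. -/
abbrev Chain (E : Type*) := List E →₀ ZMod 2

section Algebra

variable {E : Type*}

/-- The cone over a chain with apex `b`. -/
noncomputable def cone (b : E) : Chain E →ₗ[ZMod 2] Chain E :=
  Finsupp.lmapDomain (ZMod 2) (ZMod 2) (List.cons b)

/-- The boundary of an ordered simplex. -/
noncomputable def simplexBoundary : List E → Chain E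
  | [] => 0
  | a :: l => Finsupp.single l 1 + cone a (simplexBoundary l)

/-- The boundary operator. -/
noncomputable def boundary : Chain E →ₗ[ZMod 2] Chain E :=
  Finsupp.linearCombination (ZMod 2) simplexBoundary

/-- The evaluation of a cochain on chains. -/
noncomputable def pairing (φ : List E → ZMod 2) : Chain E →ₗ[ZMod 2] ZMod 2 :=
  Finsupp.linearCombination (ZMod 2) φ

@[simp] lemma cone_single (b : E) (l : List E) (t : ZMod 2) :
    cone b (Finsupp.single l t) = Finsupp.single (b :: l) t := by
  simp [cone]

@[simp] lemma boundary_single (l : List E) :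
    boundary (Finsupp.single l 1) = simplexBoundary l := by
  simp [boundary]

@[simp] lemma pairing_single (φ : List E → ZMod 2) (l : List E) :
    pairing φ (Finsupp.single l 1) = φ l := by
  simp [pairing]

/-- Linear maps on chains agree once they agree on simplices. -/
lemma chain_hom_ext {M : Type*} [AddCommMonoid M] [Module (ZMod 2) M]
    {f g : Chain E →ₗ[ZMod 2] M}
    (h : ∀ l, f (Finsupp.single l 1) = g (Finsupp.single l 1)) : f = g :=
  Finsupp.lhom_ext' fun l => LinearMap.ext_ring (h l)

lemma chain_add_self (c : Chain E) : c + c = 0 := by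
  ext l
  exact CharTwo.add_self_eq_zero _

lemma boundary_cone (b : E) (c : Chain E) :
    boundary (cone b c) = c + cone b (boundary c) := by
  have : boundary ∘ₗ cone b = LinearMap.id + cone b ∘ₗ boundary :=
    chain_hom_ext fun l => by simp [simplexBoundary]
  exact LinearMap.congr_fun this c

lemma boundary_boundary (c : Chain E) : boundary (boundary c) = 0 := by
  have : boundary ∘ₗ boundary = (0 : Chain E →ₗ[ZMod 2] Chain E) := by
    refine chain_hom_ext fun l => ?_
    simp only [LinearMap.comp_apply, boundary_single, LinearMap.zero_apply]
    induction l with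
    | nil => simp [simplexBoundary]
    | cons a l ih =>
      simp [simplexBoundary, boundary_cone, ih, chain_add_self]
  exact LinearMap.congr_fun this c

/-- The cochain `δs₁ ∪ ⋯ ∪ δsₘ` attached to functions `s₁, …, sₘ`. -/
def cup : List (E → ZMod 2) → List E → ZMod 2
  | [], [_] => 1
  | s :: ss, x :: y :: l => (s x + s y) * cup ss (y :: l)
  | _, _ => 0

/-- The cochain `s ∪ δs₁ ∪ ⋯ ∪ δsₘ`. -/
def cupLeft (s : E → ZMod 2) (ss : List (E → ZMod 2)) : List E → ZMod 2
  | [] => 0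
  | x :: l => s x * cup ss (x :: l)

lemma cup_nil_right (ss : List (E → ZMod 2)) : cup ss [] = 0 := by
  cases ss <;> rfl

lemma cup_cons_singleton (s : E → ZMod 2) (ss : List (E → ZMod 2)) (x : E) :
    cup (s :: ss) [x] = 0 := rfl

lemma cup_cons_cons (s : E → ZMod 2) (ss : List (E → ZMod 2)) (x y : E) (l : List E) :
    cup (s :: ss) (x :: y :: l) = (s x + s y) * cup ss (y :: l) := rfl

lemma pairing_cupLeft_cone (s : E → ZMod 2) (ss : List (E → ZMod 2)) (x : E) (c : Chain E) :
    pairing (cupLeft s ss) (cone x c) = s x * pairing (cup ss) (cone x c) := by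
  have : pairing (cupLeft s ss) ∘ₗ cone x = s x • (pairing (cup ss) ∘ₗ cone x) :=
    chain_hom_ext fun l => by simp [cupLeft]
  simpa using LinearMap.congr_fun this c

lemma pairing_cupLeft_boundary_of_cocycle (s : E → ZMod 2) (ss : List (E → ZMod 2))
    (h : ∀ c, pairing (cup ss) (boundary c) = 0) (c : Chain E) :
    pairing (cupLeft s ss) (boundary c) = pairing (cup (s :: ss)) c := by
  have : pairing (cupLeft s ss) ∘ₗ boundary = pairing (cup (s :: ss)) := by
    refine chain_hom_ext fun l => ?_
    match l with
    | [] => simp [simplexBoundary, cup_nil_right]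
    | [x] => simp [simplexBoundary, cupLeft, cup_cons_singleton]
    | x :: y :: l =>
      have h' := h (Finsupp.single (x :: y :: l) 1)
      rw [boundary_single, simplexBoundary, map_add, pairing_single] at h'
      rw [LinearMap.comp_apply, boundary_single, simplexBoundary, map_add,
        pairing_cupLeft_cone, eq_neg_of_add_eq_zero_right h', pairing_single, pairing_single,
        cup_cons_cons, cupLeft, CharTwo.neg_eq]
      ring
  exact LinearMap.congr_fun this c

lemma pairing_cup_nil_boundary (c : Chain E) : pairing (cup []) (boundary c) = 0 := by
  have h0 : ∀ (x y : E) (c : Chain E), pairing (cup []) (cone x (cone y c)) = 0 := by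
    intro x y c
    have : pairing (cup []) ∘ₗ cone x ∘ₗ cone y = 0 :=
      chain_hom_ext fun l => by simp [cup]
    exact LinearMap.congr_fun this c
  have : pairing (cup []) ∘ₗ boundary = (0 : Chain E →ₗ[ZMod 2] ZMod 2) := by
    refine chain_hom_ext fun l => ?_
    match l with
    | [] => simp [simplexBoundary]
    | [x] => simp [simplexBoundary, cup]
    | [x, y] => simp [simplexBoundary, cup]; rfl
    | x :: y :: z :: l => simp [simplexBoundary, cup, h0]
  exact LinearMap.congr_fun this c

lemma pairing_cup_boundary (ss : List (E → ZMod 2)) (c : Chain E) :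
    pairing (cup ss) (boundary c) = 0 := by
  cases ss with
  | nil => exact pairing_cup_nil_boundary c
  | cons s ss =>
    induction ss generalizing s c with
    | nil =>
      rw [← pairing_cupLeft_boundary_of_cocycle _ _ pairing_cup_nil_boundary,
        boundary_boundary, map_zero]
    | cons t ss ih =>
      rw [← pairing_cupLeft_boundary_of_cocycle _ _ (fun c => ih _ _), boundary_boundary, map_zero]

lemma pairing_cupLeft_boundary (s : E → ZMod 2) (ss : List (E → ZMod 2)) (c : Chain E) :
    pairing (cupLeft s ss) (boundary c) = pairing (cup (s :: ss)) c :=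
  pairing_cupLeft_boundary_of_cocycle s ss (pairing_cup_boundary ss) c

lemma exists_ne_of_cup_ne_zero {ss : List (E → ZMod 2)} {l : List E} (h : cup ss l ≠ 0) :
    ∀ s ∈ ss, ∃ y ∈ l, ∃ z ∈ l, s y ≠ s z := by
  induction ss generalizing l with
  | nil => simp
  | cons t ss ih =>
    match l with
    | [] => exact absurd (cup_nil_right _) h
    | [x] => exact absurd (cup_cons_singleton _ _ _) h
    | x :: y :: l =>
      rw [cup_cons_cons] at h
      intro s hs
      rcases List.mem_cons.1 hs with rfl | hs
      · refine ⟨x, by simp, y, by simp, fun hxy => h ?_⟩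
        rw [hxy, CharTwo.add_self_eq_zero, zero_mul]
      · obtain ⟨a, ha, b, hb, hab⟩ := ih (right_ne_zero_of_mul h) s hs
        exact ⟨a, List.mem_cons_of_mem _ ha, b, List.mem_cons_of_mem _ hb, hab⟩

/-- A linear map sends chains supported in `A` to chains supported in `B` as soon as it does so
for simplices. -/
lemma map_mem_supported (f : Chain E →ₗ[ZMod 2] Chain E) {A B : Set (List E)}
    (h : ∀ l ∈ A, f (Finsupp.single l 1) ∈ Finsupp.supported (ZMod 2) (ZMod 2) B)
    {c : Chain E} (hc : c ∈ Finsupp.supported (ZMod 2) (ZMod 2) A) :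
    f c ∈ Finsupp.supported (ZMod 2) (ZMod 2) B := by
  rw [Finsupp.supported_eq_span_single] at hc
  refine (Submodule.span_le (p := (Finsupp.supported (ZMod 2) (ZMod 2) B).comap f)).2 ?_ hc
  rintro _ ⟨l, hl, rfl⟩
  exact h l hl

lemma cone_mem_supported (b : E) {A B : Set (List E)} (h : ∀ l ∈ A, b :: l ∈ B)
    {c : Chain E} (hc : c ∈ Finsupp.supported (ZMod 2) (ZMod 2) A) :
    cone b c ∈ Finsupp.supported (ZMod 2) (ZMod 2) B :=
  map_mem_supported _ (fun l hl => by
    rw [cone_single]; exact Finsupp.single_mem_supported _ _ (h l hl)) hc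

lemma simplexBoundary_mem_supported (l : List E) :
    simplexBoundary l ∈ Finsupp.supported (ZMod 2) (ZMod 2)
      {l' | l'.length + 1 = l.length ∧ l' ⊆ l} := by
  induction l with
  | nil => exact Submodule.zero_mem _
  | cons a l ih =>
    refine Submodule.add_mem _ (Finsupp.single_mem_supported _ _ ⟨rfl, by simp⟩)
      (cone_mem_supported a ?_ ih)
    rintro l' ⟨h1, h2⟩
    exact ⟨by simp [h1], List.cons_subset_cons a h2⟩

end Algebra

section Antipode

variable {E : Type*} [AddCommGroup E]

/-- The action of the antipodal map on chains. -/
noncomputable def antipode : Chain E →ₗ[ZMod 2] Chain E :=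
  Finsupp.lmapDomain (ZMod 2) (ZMod 2) (List.map Neg.neg)

@[simp] lemma antipode_single (l : List E) (t : ZMod 2) :
    antipode (Finsupp.single l t) = Finsupp.single (l.map Neg.neg) t := by
  simp [antipode]

lemma antipode_cone (b : E) (c : Chain E) : antipode (cone b c) = cone (-b) (antipode c) := by
  have : antipode ∘ₗ cone b = cone (-b) ∘ₗ antipode := chain_hom_ext fun l => by simp
  exact LinearMap.congr_fun this c

lemma antipode_simplexBoundary (l : List E) :
    antipode (simplexBoundary l) = simplexBoundary (l.map Neg.neg) := by
  induction l with
  | nil => simp [simplexBoundary]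
  | cons a l ih => simp [simplexBoundary, antipode_cone, ih]

lemma boundary_antipode (c : Chain E) : boundary (antipode c) = antipode (boundary c) := by
  have : boundary ∘ₗ antipode = antipode ∘ₗ (boundary (E := E)) :=
    chain_hom_ext fun l => by simp [antipode_simplexBoundary]
  exact LinearMap.congr_fun this c

lemma antipode_antipode (c : Chain E) : antipode (antipode c) = c := by
  have : antipode ∘ₗ antipode = (LinearMap.id : Chain E →ₗ[ZMod 2] Chain E) :=
    chain_hom_ext fun l => by simp
  exact LinearMap.congr_fun this c

/-- The cross-polytope sphere with vertices `±e₀, …, ±eₖ₋₁`. -/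
noncomputable def crossPolytope (e : ℕ → E) : ℕ → Chain E
  | 0 => Finsupp.single [] 1
  | k + 1 => cone (e k) (crossPolytope e k) + antipode (cone (e k) (crossPolytope e k))

lemma boundary_crossPolytope (e : ℕ → E) (k : ℕ) : boundary (crossPolytope e k) = 0 := by
  induction k with
  | zero => simp [crossPolytope, simplexBoundary]
  | succ k ih =>
    have h : antipode (crossPolytope e k) = crossPolytope e k := by
      cases k with
      | zero => simp [crossPolytope]
      | succ k => rw [crossPolytope, map_add, antipode_antipode, add_comm]
    rw [crossPolytope, map_add, boundary_antipode, boundary_cone, ih, map_zero, add_zero, h,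
      chain_add_self]

lemma cup_map_neg {ss : List (E → ZMod 2)} (hs : ∀ s ∈ ss, ∀ x ≠ 0, s (-x) = s x + 1)
    {l : List E} (hl : ∀ x ∈ l, x ≠ 0) : cup ss (l.map Neg.neg) = cup ss l := by
  induction ss generalizing l with
  | nil =>
    match l with
    | [] => rfl
    | [x] => rfl
    | x :: y :: l => rfl
  | cons s ss ih =>
    match l with
    | [] => rfl
    | [x] => rfl
    | x :: y :: l =>
      have := ih (fun s h => hs s (by simp [h])) (l := y :: l)
        (fun x hx => hl x (List.mem_cons_of_mem _ hx))
      simp only [List.map_cons] at this ⊢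
      rw [cup_cons_cons, cup_cons_cons, this, hs s (by simp) x (hl x (by simp)),
        hs s (by simp) y (hl y (by simp)), add_add_add_comm, CharTwo.add_self_eq_zero, add_zero]

lemma cupLeft_map_neg {s : E → ZMod 2} {ss : List (E → ZMod 2)}
    (hs : ∀ t ∈ s :: ss, ∀ x ≠ 0, t (-x) = t x + 1)
    {l : List E} (hl : ∀ x ∈ l, x ≠ 0) :
    cupLeft s ss l + cupLeft s ss (l.map Neg.neg) = cup ss l := by
  cases l with
  | nil => simp [cupLeft, cup_nil_right]
  | cons x l =>
    have := cup_map_neg (fun t ht => hs t (List.mem_cons_of_mem _ ht)) hl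
    rw [List.map_cons] at this ⊢
    rw [cupLeft, cupLeft, this, hs s (by simp) x (hl x (by simp)), ← add_mul, ← add_assoc,
      CharTwo.add_self_eq_zero, zero_add, one_mul]

lemma pairing_cupLeft_add_antipode {s : E → ZMod 2} {ss : List (E → ZMod 2)}
    (hs : ∀ t ∈ s :: ss, ∀ x ≠ 0, t (-x) = t x + 1) {c : Chain E}
    (hc : c ∈ Finsupp.supported (ZMod 2) (ZMod 2) {l | ∀ x ∈ l, x ≠ 0}) :
    pairing (cupLeft s ss) (c + antipode c) = pairing (cup ss) c := by
  rw [Finsupp.supported_eq_span_single] at hc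
  refine LinearMap.eqOn_span (f := pairing (cupLeft s ss) ∘ₗ (LinearMap.id + antipode))
    (g := pairing (cup ss)) ?_ hc
  rintro _ ⟨l, hl, rfl⟩
  simp [cupLeft_map_neg hs hl]

end Antipode

section Subdivision

variable {E : Type*} [AddCommGroup E] [Module ℝ E]

/-- The barycenter of a simplex. -/
noncomputable def barycenter (l : List E) : E := (l.length : ℝ)⁻¹ • l.sum

/-- Barycentric subdivision of chains of simplices with `m` vertices. -/
noncomputable def subdivision : ℕ → Chain E →ₗ[ZMod 2] Chain E
  | 0 => LinearMap.id
  | m + 1 => Finsupp.linearCombination (ZMod 2)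
      fun l => cone (barycenter l) (subdivision m (simplexBoundary l))

@[simp] lemma subdivision_succ_single (m : ℕ) (l : List E) :
    subdivision (m + 1) (Finsupp.single l 1) =
      cone (barycenter l) (subdivision m (simplexBoundary l)) := by
  simp [subdivision]

lemma boundary_subdivision (m : ℕ) (c : Chain E) :
    boundary (subdivision (m + 1) c) = subdivision m (boundary c) := by
  have : boundary ∘ₗ subdivision (m + 1) = subdivision m ∘ₗ (boundary (E := E)) := by
    refine chain_hom_ext fun l => ?_
    have hb : boundary (simplexBoundary l) = 0 := by
      rw [← boundary_single, boundary_boundary]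
    simp only [LinearMap.comp_apply, subdivision_succ_single, boundary_single, boundary_cone]
    cases m with
    | zero => simp [subdivision, hb]
    | succ m => rw [boundary_subdivision m, hb, map_zero, map_zero, add_zero]
  exact LinearMap.congr_fun this c

lemma barycenter_map_neg (l : List E) : barycenter (l.map Neg.neg) = -barycenter l := by
  have : (l.map Neg.neg).sum = -l.sum := by
    induction l with
    | nil => simp
    | cons a l ih => simp [ih, add_comm]
  simp [barycenter, this]

lemma subdivision_antipode (m : ℕ) (c : Chain E) :
    subdivision m (antipode c) = antipode (subdivision m c) := by
  induction m generalizing c with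
  | zero => rfl
  | succ m ih =>
    have : subdivision (m + 1) ∘ₗ antipode = antipode ∘ₗ subdivision (E := E) (m + 1) :=
      chain_hom_ext fun l => by
        simp [barycenter_map_neg, ← antipode_simplexBoundary, ih, antipode_cone]
    exact LinearMap.congr_fun this c

/-- The iterated barycentric subdivision of a hemisphere of the cross-polytope. -/
noncomputable def hemisphere (e : ℕ → E) (r k : ℕ) : Chain E :=
  (subdivision (k + 1))^[r] (cone (e k) (crossPolytope e k))

lemma boundary_hemisphere (e : ℕ → E) (r k : ℕ) :
    boundary (hemisphere e r (k + 1)) = hemisphere e r k + antipode (hemisphere e r k) := by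
  unfold hemisphere
  induction r with
  | zero =>
    simp [boundary_cone, boundary_crossPolytope]
    rfl
  | succ r ih =>
    simp only [Function.iterate_succ_apply', boundary_subdivision, ih, map_add,
      subdivision_antipode]

lemma pairing_cup_nil_hemisphere (e : ℕ → E) (r : ℕ) :
    pairing (cup []) (hemisphere e r 0) = 1 := by
  have : hemisphere e r 0 = Finsupp.single [e 0] 1 := by
    unfold hemisphere
    induction r with
    | zero => simp [crossPolytope]
    | succ r ih =>
      rw [Function.iterate_succ_apply', ih]
      simp [simplexBoundary, subdivision, barycenter]
  simp [this, cup]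

/-- The combinatorial core of the Borsuk–Ulam theorem. -/
lemma pairing_cup_hemisphere (e : ℕ → E) (r : ℕ) (ss : List (E → ZMod 2))
    (hs : ∀ s ∈ ss, ∀ x ≠ 0, s (-x) = s x + 1)
    (he : ∀ k < ss.length,
      hemisphere e r k ∈ Finsupp.supported (ZMod 2) (ZMod 2) {l | ∀ x ∈ l, x ≠ 0}) :
    pairing (cup ss) (hemisphere e r ss.length) = 1 := by
  induction ss with
  | nil => exact pairing_cup_nil_hemisphere e r
  | cons s ss ih =>
    rw [List.length_cons, ← pairing_cupLeft_boundary, boundary_hemisphere,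
      pairing_cupLeft_add_antipode hs (he _ (by simp))]
    exact ih (fun t ht => hs t (List.mem_cons_of_mem _ ht))
      fun k hk => he k (by simp; omega)

end Subdivision

section Mesh

variable {E : Type*} [NormedAddCommGroup E] [NormedSpace ℝ E]

lemma barycenter_mem {K : Set E} (hK : Convex ℝ K) {l : List E} (hl : l ≠ [])
    (h : ∀ x ∈ l, x ∈ K) : barycenter l ∈ K := by
  have h0 : (l.length : ℝ) ≠ 0 := by simpa using hl
  have : barycenter l = ∑ i : Fin l.length, (l.length : ℝ)⁻¹ • l[i] := by
    rw [barycenter, ← Finset.smul_sum]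
    exact congrArg _ (Fin.sum_univ_getElem l).symm
  rw [this]
  exact hK.sum_mem (fun _ _ => by positivity) (by simp [h0]) fun i _ => h _ (by simp)

lemma dist_barycenter_le {N : ℕ} {D : ℝ} (hD : 0 ≤ D) {l : List E} (hN : l.length ≤ N + 1)
    {v : E} (hv : v ∈ l) (h : ∀ x ∈ l, dist x v ≤ D) :
    dist v (barycenter l) ≤ N / (N + 1) * D := by
  obtain ⟨j, rfl⟩ := List.get_of_mem hv
  have hpos : 0 < (l.length : ℝ) := by
    exact_mod_cast List.length_pos_of_mem hv
  have hb : barycenter l - l.get j = (l.length : ℝ)⁻¹ • ∑ i, (l.get i - l.get j) := by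
    rw [Finset.sum_sub_distrib, smul_sub, barycenter]
    congr 1
    · simp
    · simp [← Nat.cast_smul_eq_nsmul ℝ, smul_smul, hpos.ne']
  have hsum : ‖∑ i, (l.get i - l.get j)‖ ≤ (l.length - 1) * D := by
    rw [← Finset.add_sum_erase _ _ (Finset.mem_univ j), sub_self, zero_add]
    refine (norm_sum_le_of_le (n := fun _ => D) _ fun i _ => ?_).trans_eq ?_
    · rw [← dist_eq_norm]
      exact h _ (by simp)
    · rw [Finset.sum_const, Finset.card_erase_of_mem (Finset.mem_univ j), nsmul_eq_mul,
        Finset.card_univ, Fintype.card_fin, Nat.cast_sub (List.length_pos_of_mem hv), Nat.cast_one]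
  rw [dist_comm, dist_eq_norm, hb, norm_smul, norm_inv, Real.norm_of_nonneg hpos.le]
  have hN' : (l.length : ℝ) ≤ N + 1 := by exact_mod_cast hN
  calc (l.length : ℝ)⁻¹ * ‖∑ i, (l.get i - l.get j)‖
      ≤ (l.length : ℝ)⁻¹ * ((l.length - 1) * D) := by gcongr
    _ = (l.length : ℝ)⁻¹ * (l.length - 1) * D := by ring
    _ ≤ N / (N + 1) * D := by
      gcongr
      rw [inv_mul_eq_div, div_le_div_iff₀ hpos (by positivity)]
      nlinarith

/-- The simplices with `m` vertices, of diameter at most `D`, lying in a member of `𝒦`. -/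
def fineSimplices (𝒦 : Set (Set E)) (m : ℕ) (D : ℝ) : Set (List E) :=
  {l | l.length = m ∧ (∃ K ∈ 𝒦, ∀ x ∈ l, x ∈ K) ∧ ∀ x ∈ l, ∀ y ∈ l, dist x y ≤ D}

lemma subdivision_single_mem_supported (N m : ℕ) (hm : m ≤ N + 1) {D : ℝ} (hD : 0 ≤ D)
    {l : List E} (hl : l.length = m) (h : ∀ x ∈ l, ∀ y ∈ l, dist x y ≤ D) :
    subdivision m (Finsupp.single l 1) ∈ Finsupp.supported (ZMod 2) (ZMod 2)
      (fineSimplices {convexHull ℝ {x | x ∈ l}} m (N / (N + 1) * D)) := by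
  induction m generalizing l with
  | zero =>
    obtain rfl := List.length_eq_zero_iff.1 hl
    exact Finsupp.single_mem_supported _ _ ⟨rfl, by simp, by simp⟩
  | succ m ih =>
    rw [subdivision_succ_single]
    have hne : l ≠ [] := List.ne_nil_of_length_eq_add_one hl
    have hb : barycenter l ∈ convexHull ℝ {x | x ∈ l} :=
      barycenter_mem (convex_convexHull ℝ _) hne fun x hx => subset_convexHull ℝ _ hx
    refine cone_mem_supported (A := fineSimplices {convexHull ℝ {x | x ∈ l}} m
      (N / (N + 1) * D)) _ ?_ (map_mem_supported _ ?_ (simplexBoundary_mem_supported l))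
    · rintro τ ⟨h1, ⟨_, rfl, h2⟩, h3⟩
      have h4 : ∀ y ∈ τ, dist y (barycenter l) ≤ N / (N + 1) * D := by
        intro y hy
        have : convexHull ℝ {x | x ∈ l} ⊆ Metric.closedBall (barycenter l) (N / (N + 1) * D) :=
          convexHull_min (fun v hv => dist_barycenter_le hD (hl.trans_le hm) hv
            fun x hx => h x hx v hv) (convex_closedBall _ _)
        exact this (h2 y hy)
      refine ⟨by simp [h1], ⟨_, rfl, ?_⟩, ?_⟩
      · simpa [hb] using h2
      · have h0 : 0 ≤ N / (N + 1) * D := by positivity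
        have h5 : ∀ y ∈ τ, dist (barycenter l) y ≤ N / (N + 1) * D := fun y hy => by
          rw [dist_comm]; exact h4 y hy
        simp only [List.mem_cons, forall_eq_or_imp, dist_self]
        exact ⟨⟨h0, h5⟩, fun x hx => ⟨h4 x hx, h3 x hx⟩⟩
    · rintro τ ⟨h1, h2⟩
      refine Finsupp.supported_mono ?_ (ih (by omega) (l := τ) (by omega)
        fun x hx y hy => h x (h2 hx) y (h2 hy))
      rintro ρ ⟨g1, ⟨_, rfl, g2⟩, g3⟩
      exact ⟨g1, ⟨_, rfl, fun x hx => convexHull_mono (fun y hy => h2 hy) (g2 x hx)⟩, g3⟩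

lemma subdivision_mem_supported {𝒦 : Set (Set E)} (h𝒦 : ∀ K ∈ 𝒦, Convex ℝ K)
    {N m : ℕ} (hm : m ≤ N + 1) {D : ℝ} (hD : 0 ≤ D) {c : Chain E}
    (hc : c ∈ Finsupp.supported (ZMod 2) (ZMod 2) (fineSimplices 𝒦 m D)) :
    subdivision m c ∈ Finsupp.supported (ZMod 2) (ZMod 2)
      (fineSimplices 𝒦 m (N / (N + 1) * D)) := by
  refine map_mem_supported _ ?_ hc
  rintro l ⟨h1, ⟨K, hK, h2⟩, h3⟩
  refine Finsupp.supported_mono ?_ (subdivision_single_mem_supported N m hm hD h1 h3)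
  rintro ρ ⟨g1, ⟨_, rfl, g2⟩, g3⟩
  exact ⟨g1, ⟨K, hK, fun x hx => convexHull_min h2 (h𝒦 K hK) (g2 x hx)⟩, g3⟩

lemma iterate_subdivision_mem_supported {𝒦 : Set (Set E)} (h𝒦 : ∀ K ∈ 𝒦, Convex ℝ K)
    {N m : ℕ} (hm : m ≤ N + 1) {D : ℝ} (hD : 0 ≤ D) {c : Chain E}
    (hc : c ∈ Finsupp.supported (ZMod 2) (ZMod 2) (fineSimplices 𝒦 m D)) (r : ℕ) :
    (subdivision m)^[r] c ∈ Finsupp.supported (ZMod 2) (ZMod 2)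
      (fineSimplices 𝒦 m ((N / (N + 1)) ^ r * D)) := by
  induction r with
  | zero => simpa using hc
  | succ r ih =>
    rw [Function.iterate_succ_apply', pow_succ', mul_assoc]
    exact subdivision_mem_supported h𝒦 hm (by positivity) ih

end Mesh

section Euclidean

variable {n : ℕ}

/-- The coordinate vectors, extended by zero. -/
def coordVector (n k : ℕ) : Fin (n + 1) → ℝ := fun i => if i.val = k then 1 else 0

/-- The simplices lying in a face of the cross-polytope with vertices `±e₀, …, ±eₖ₋₁`. -/
def faceSimplices (n k : ℕ) : Set (List (Fin (n + 1) → ℝ)) :=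
  {l | l.length = k ∧ ∃ ε : Fin (n + 1) → ℝ, (∀ i, |ε i| ≤ 1) ∧
    ∀ x ∈ l, ‖x‖ ≤ 1 ∧ ε ⬝ᵥ x = 1 ∧ ∀ i, k ≤ i.val → x i = 0}

lemma cone_coordVector_mem_supported {k : ℕ} (hk : k ≤ n) {c : Chain (Fin (n + 1) → ℝ)}
    (hc : c ∈ Finsupp.supported (ZMod 2) (ZMod 2) (faceSimplices n k)) :
    cone (coordVector n k) c ∈ Finsupp.supported (ZMod 2) (ZMod 2)
      (faceSimplices n (k + 1)) := by
  refine cone_mem_supported _ ?_ hc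
  rintro l ⟨h1, ε, h2, h3⟩
  refine ⟨by simp [h1], fun i => if i.val = k then 1 else ε i, fun i => ?_, fun x hx => ?_⟩
  · by_cases hi : i.val = k <;> simp [hi, h2]
  · rcases List.mem_cons.1 hx with rfl | hx
    · refine ⟨(pi_norm_le_iff_of_nonneg zero_le_one).2 fun i => ?_, ?_, fun i hi => ?_⟩
      · by_cases hi : i.val = k <;> simp [coordVector, hi]
      · rw [dotProduct, Finset.sum_eq_single ⟨k, by omega⟩]
        · simp [coordVector]
        · intro b _ hb
          have : b.val ≠ k := fun h => hb (Fin.ext h)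
          simp [coordVector, this]
        · simp
      · have : i.val ≠ k := by omega
        simp [coordVector, this]
    · obtain ⟨g1, g2, g3⟩ := h3 x hx
      refine ⟨g1, ?_, fun i hi => g3 i (by omega)⟩
      rw [← g2]
      refine Finset.sum_congr rfl fun i _ => ?_
      by_cases hi : i.val = k
      · simp [g3 i hi.ge]
      · simp [hi]

lemma crossPolytope_mem_supported {k : ℕ} (hk : k ≤ n + 1) :
    crossPolytope (coordVector n) k ∈ Finsupp.supported (ZMod 2) (ZMod 2)
      (faceSimplices n k) := by
  induction k with
  | zero => exact Finsupp.single_mem_supported _ _ ⟨rfl, 0, by simp, by simp⟩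
  | succ k ih =>
    have h := cone_coordVector_mem_supported (by omega) (ih (by omega))
    refine Submodule.add_mem _ h (map_mem_supported _ ?_ h)
    rintro l ⟨h1, ε, h2, h3⟩
    rw [antipode_single]
    refine Finsupp.single_mem_supported _ _ ⟨by simp [h1], -ε, by simpa using h2, fun x hx => ?_⟩
    obtain ⟨y, hy, rfl⟩ := List.mem_map.1 hx
    simpa using h3 y hy

/-- An annulus containing the boundary of the cross-polytope. -/
def annulus (n : ℕ) : Set (Fin (n + 1) → ℝ) := {x | ‖x‖ ≤ 1 ∧ 1 ≤ (n + 1) * ‖x‖}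

lemma isCompact_annulus (n : ℕ) : IsCompact (annulus n) := by
  have : annulus n = Metric.closedBall 0 1 ∩ {x | 1 ≤ (n + 1) * ‖x‖} := by
    ext x; simp [annulus]
  rw [this]
  exact (isCompact_closedBall _ _).inter_right (isClosed_le (by fun_prop) (by fun_prop))

lemma ne_zero_of_mem_annulus {x : Fin (n + 1) → ℝ} (hx : x ∈ annulus n) : x ≠ 0 := by
  rintro rfl
  have := hx.2
  norm_num at this

lemma faceSimplices_subset (n k : ℕ) :
    faceSimplices n k ⊆ fineSimplices {K | Convex ℝ K ∧ K ⊆ annulus n} k 2 := by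
  rintro l ⟨h1, ε, h2, h3⟩
  refine ⟨h1, ⟨Metric.closedBall 0 1 ∩ {x | ε ⬝ᵥ x = 1}, ⟨?_, ?_⟩, ?_⟩, ?_⟩
  · refine (convex_closedBall _ _).inter (convex_hyperplane ⟨?_, ?_⟩ 1)
    · exact fun x y => dotProduct_add _ _ _
    · exact fun c x => dotProduct_smul _ _ _
  · rintro x ⟨hx1, hx2⟩
    refine ⟨by simpa using hx1, ?_⟩
    refine (show (1 : ℝ) = ε ⬝ᵥ x from hx2.symm).trans_le
      ((Finset.sum_le_card_nsmul Finset.univ _ ‖x‖ fun i _ => ?_).trans_eq (by simp))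
    calc ε i * x i ≤ |ε i| * |x i| := (le_abs_self _).trans_eq (abs_mul _ _)
      _ ≤ 1 * ‖x‖ := by
        gcongr
        · exact h2 i
        · exact norm_le_pi_norm x i
      _ = ‖x‖ := one_mul _
  · exact fun x hx => ⟨by simpa using (h3 x hx).1, (h3 x hx).2.1⟩
  · intro x hx y hy
    calc dist x y ≤ ‖x‖ + ‖y‖ := dist_le_norm_add_norm x y
      _ ≤ 1 + 1 := add_le_add (h3 x hx).1 (h3 y hy).1
      _ = 2 := by norm_num

lemma hemisphere_mem_supported {k : ℕ} (hk : k ≤ n) (r : ℕ) :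
    hemisphere (coordVector n) r k ∈ Finsupp.supported (ZMod 2) (ZMod 2)
      (fineSimplices {K | Convex ℝ K ∧ K ⊆ annulus n} (k + 1) ((n / (n + 1)) ^ r * 2)) :=
  iterate_subdivision_mem_supported (fun _ h => h.1) (by omega) zero_le_two
    (Finsupp.supported_mono (faceSimplices_subset n _)
      (cone_coordVector_mem_supported hk (crossPolytope_mem_supported (by omega)))) r

lemma exists_fine_simplex (r : ℕ) (s : Fin n → (Fin (n + 1) → ℝ) → ZMod 2)
    (hs : ∀ i, ∀ x ≠ 0, s i (-x) = s i x + 1) :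
    ∃ l : List (Fin (n + 1) → ℝ), l ≠ [] ∧ (∀ x ∈ l, x ∈ annulus n) ∧
      (∀ x ∈ l, ∀ y ∈ l, dist x y ≤ (n / (n + 1)) ^ r * 2) ∧
      ∀ i, ∃ y ∈ l, ∃ z ∈ l, s i y ≠ s i z := by
  have hpair := pairing_cup_hemisphere (coordVector n) r (List.ofFn s)
    (by simpa [List.mem_ofFn] using hs) fun k hk => by
      refine Finsupp.supported_mono ?_ (hemisphere_mem_supported (by simp at hk; omega) r)
      rintro l ⟨-, ⟨K, hK, h⟩, -⟩ x hx
      exact ne_zero_of_mem_annulus (hK.2 (h x hx))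
  rw [List.length_ofFn] at hpair
  obtain ⟨l, hl, hl'⟩ : ∃ l ∈ (hemisphere (coordVector n) r n).support,
      cup (List.ofFn s) l ≠ 0 := by
    by_contra! H
    rw [pairing, Finsupp.linearCombination_apply, Finsupp.sum, Finset.sum_eq_zero] at hpair
    · exact zero_ne_one hpair
    · intro l hl
      rw [H l hl, smul_zero]
  obtain ⟨h1, ⟨K, hK, h2⟩, h3⟩ := hemisphere_mem_supported le_rfl r hl
  exact ⟨l, List.ne_nil_of_length_eq_add_one h1, fun x hx => hK.2 (h2 x hx), h3,
    fun i => exists_ne_of_cup_ne_zero hl' _ (by simp)⟩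

lemma exists_antipodal_coloring (E : Type*) [AddCommGroup E] [IsAddTorsionFree E] :
    ∃ σ : E → ZMod 2, ∀ x ≠ 0, σ (-x) = σ x + 1 := by
  classical
  refine ⟨fun x => if WellOrderingRel x (-x) then 1 else 0, fun x hx => ?_⟩
  have hne : x ≠ -x := fun h => hx (self_eq_neg.1 h)
  have has : ∀ a b : E, WellOrderingRel a b → ¬ WellOrderingRel b a := fun a b => asymm
  rcases trichotomous_of WellOrderingRel x (-x) with h | h | h
  · have h2 := has _ _ h
    simp [h, h2]
    rfl
  · exact absurd h hne
  · have h2 := has _ _ h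
    simp [h, h2]

lemma exists_antipodal_sign {E : Type*} [AddCommGroup E] [IsAddTorsionFree E] (g : E → ℝ)
    (hg : ∀ x ≠ 0, g (-x) = -g x) :
    ∃ s : E → ZMod 2, (∀ x ≠ 0, s (-x) = s x + 1) ∧ ∀ y z, s y ≠ s z → g y * g z ≤ 0 := by
  classical
  obtain ⟨σ, hσ⟩ := exists_antipodal_coloring E
  refine ⟨fun x => if 0 < g x then 1 else if g x < 0 then 0 else σ x, fun x hx => ?_,
    fun y z h => ?_⟩
  · rcases lt_trichotomy (g x) 0 with h | h | h
    · simp [hg x hx, h, h.not_gt]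
    · simp [hg x hx, h, hσ x hx]
    · simp [hg x hx, h, h.not_gt]
      rfl
  · by_contra! H
    rcases pos_and_pos_or_neg_and_neg_of_mul_pos H with ⟨h1, h2⟩ | ⟨h1, h2⟩
    · simp [h1, h2] at h
    · simp [h1, h2, h1.not_gt, h2.not_gt] at h

/-- The **Borsuk–Ulam theorem**: an odd continuous map `ℝⁿ⁺¹ \ {0} → ℝⁿ` has a zero. -/
theorem exists_zero_of_odd (f : (Fin (n + 1) → ℝ) → (Fin n → ℝ))
    (hf : ContinuousOn f {0}ᶜ) (hodd : ∀ x ≠ 0, f (-x) = -f x) : ∃ x ≠ 0, f x = 0 := by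
  by_contra! H
  choose s hs hs' using fun i => exists_antipodal_sign (fun x => f x i)
    fun x hx => by rw [hodd x hx]; rfl
  have hc : ContinuousOn f (annulus n) :=
    hf.mono fun x hx => ne_zero_of_mem_annulus hx
  have hne : (annulus n).Nonempty := by
    obtain ⟨l, hl, hl', -⟩ := exists_fine_simplex 0 s hs
    obtain ⟨x, hx⟩ := List.exists_mem_of_ne_nil l hl
    exact ⟨x, hl' x hx⟩
  obtain ⟨x₀, hx₀, hmin⟩ := (isCompact_annulus n).exists_isMinOn hne hc.norm
  have hpos : 0 < ‖f x₀‖ := norm_pos_iff.2 (H x₀ (ne_zero_of_mem_annulus hx₀))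
  obtain ⟨δ, hδ, hu⟩ := Metric.uniformContinuousOn_iff.1
    ((isCompact_annulus n).uniformContinuousOn_of_continuous hc) _ hpos
  obtain ⟨r, hr⟩ : ∃ r : ℕ, ((n : ℝ) / (n + 1)) ^ r * 2 < δ := by
    obtain ⟨r, hr⟩ := exists_pow_lt_of_lt_one (half_pos hδ)
      (show (n : ℝ) / (n + 1) < 1 by rw [div_lt_one (by positivity)]; linarith)
    exact ⟨r, by linarith⟩
  obtain ⟨l, hl, hl1, hl2, hl3⟩ := exists_fine_simplex r s hs
  obtain ⟨x, hx⟩ := List.exists_mem_of_ne_nil l hl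
  obtain ⟨i, hi⟩ : ∃ i, ‖f x₀‖ ≤ |f x i| := by
    by_contra! h
    exact absurd ((pi_norm_lt_iff hpos).2 h) (not_lt.2 (hmin (hl1 x hx)))
  have key : ∀ y ∈ l, 0 < f x i * f y i := by
    intro y hy
    have h1 : |f y i - f x i| < |f x i| := by
      refine lt_of_lt_of_le ?_ hi
      refine lt_of_le_of_lt ?_ (hu y (hl1 y hy) x (hl1 x hx) ((hl2 y hy x hx).trans_lt hr))
      rw [dist_eq_norm]
      exact norm_le_pi_norm (f y - f x) i
    nlinarith [sq_lt_sq.2 h1, sq_nonneg (f y i)]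
  obtain ⟨y, hy, z, hz, hyz⟩ := hl3 i
  have h1 := key y hy
  have h2 := key z hz
  nlinarith [hs' i y z hyz, mul_pos h1 h2, sq_nonneg (f x i)]

/-- The **Borsuk–Ulam theorem**: an odd continuous map `Sⁿ → ℝⁿ` has a zero. -/
theorem exists_zero_of_odd_sphere {m : ℕ} (hm : m = n + 1)
    (f : EuclideanSpace ℝ (Fin m) → (Fin n → ℝ)) (hf : ContinuousOn f (Metric.sphere 0 1))
    (hodd : ∀ x ∈ Metric.sphere 0 1, f (-x) = -f x) :
    ∃ x ∈ Metric.sphere (0 : EuclideanSpace ℝ (Fin m)) 1, f x = 0 := by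
  subst hm
  set ν : (Fin (n + 1) → ℝ) → EuclideanSpace ℝ (Fin (n + 1)) :=
    fun x => ‖WithLp.toLp 2 x‖⁻¹ • WithLp.toLp 2 x with hν
  have hne : ∀ x : Fin (n + 1) → ℝ, x ≠ 0 → ‖WithLp.toLp 2 x‖ ≠ 0 := fun x hx => by
    simpa using hx
  have hmem : ∀ x ≠ 0, ν x ∈ Metric.sphere 0 1 := fun x hx => by
    rw [mem_sphere_zero_iff_norm, hν, norm_smul, norm_inv, norm_norm, inv_mul_cancel₀ (hne x hx)]
  have hcont : ContinuousOn ν {0}ᶜ :=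
    ContinuousOn.smul (ContinuousOn.inv₀ (by fun_prop) hne) (by fun_prop)
  obtain ⟨x, hx, hfx⟩ := exists_zero_of_odd (f ∘ ν) (hf.comp hcont hmem) fun x hx => by
    simpa [hν] using hodd _ (hmem x hx)
  exact ⟨ν x, hmem x hx, hfx⟩

end Euclidean

end BorsukUlam

open BorsukUlam

/-- A finite cover of the unit sphere by relatively open antipode-free sets gives rise to a
nonvanishing odd map into the hyperplane `∑ i, yᵢ = 0` whose `i`-th coordinate is positive only
on the `i`-th set. -/
lemma exists_odd_map_of_cover {E ι : Type*} [NormedAddCommGroup E]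
    [NormedSpace ℝ E] [Fintype ι] (U : ι → Set E)
    (hopen : ∀ i, ∃ V, IsOpen V ∧ U i = V ∩ Metric.sphere 0 1)
    (hcover : Metric.sphere (0 : E) 1 ⊆ ⋃ i, U i)
    (hanti : ∀ i, ∀ x, x ∈ U i → -x ∉ U i) :
    ∃ g : E → ι → ℝ, ContinuousOn g (Metric.sphere 0 1) ∧ (∀ x, g (-x) = -g x) ∧
      ∀ x ∈ Metric.sphere (0 : E) 1,
        ∑ i, g x i = 0 ∧ g x ≠ 0 ∧ ∀ i, 0 < g x i → x ∈ U i := by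
  set S := Metric.sphere (0 : E) 1 with hS
  have hneg : ∀ x ∈ S, -x ∈ S := fun x hx => by simpa [hS] using hx
  set φ : ι → E → ℝ := fun i x => Metric.infDist x (S \ U i) with hφ
  have hφ0 : ∀ i x, 0 ≤ φ i x := fun i x => Metric.infDist_nonneg
  have hφpos : ∀ i, ∀ x ∈ S, 0 < φ i x ↔ x ∈ U i := by
    intro i x hx
    obtain ⟨V, hV, hUV⟩ := hopen i
    have hclosed : IsClosed (S \ U i) := by
      have : S \ U i = S ∩ Vᶜ := by ext y; simp [hUV]
      rw [this]
      exact Metric.isClosed_sphere.inter hV.isClosed_compl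
    have hne : (S \ U i).Nonempty := by
      by_cases h : x ∈ U i
      · exact ⟨-x, hneg x hx, hanti i x h⟩
      · exact ⟨x, hx, h⟩
    rw [← hclosed.notMem_iff_infDist_pos hne]
    simp [hx]
  have hφcont : ∀ i, Continuous (φ i) := fun i => Metric.continuous_infDist_pt _
  set P : E → ℝ := fun x => ∑ i, φ i x with hP
  have hPcont : Continuous P := continuous_finsetSum _ fun i _ => hφcont i
  have hPpos : ∀ x ∈ S, 0 < P x := by
    intro x hx
    obtain ⟨i, hi⟩ := Set.mem_iUnion.1 (hcover hx)
    exact Finset.sum_pos' (fun i _ => hφ0 i x) ⟨i, Finset.mem_univ i, (hφpos i x hx).2 hi⟩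
  refine ⟨fun x i => φ i x / P x - φ i (-x) / P (-x), ?_, fun x => ?_, fun x hx => ⟨?_, ?_, ?_⟩⟩
  · refine continuousOn_pi.2 fun i => ContinuousOn.sub ?_ ?_
    · exact (hφcont i).continuousOn.div hPcont.continuousOn fun x hx => (hPpos x hx).ne'
    · exact ((hφcont i).comp continuous_neg).continuousOn.div
        (hPcont.comp continuous_neg).continuousOn fun x hx => (hPpos _ (hneg x hx)).ne'
  · ext i
    simp
  · rw [Finset.sum_sub_distrib, ← Finset.sum_div, ← Finset.sum_div]
    change P x / P x - P (-x) / P (-x) = 0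
    rw [div_self (hPpos x hx).ne', div_self (hPpos _ (hneg x hx)).ne', sub_self]
  · intro h
    obtain ⟨i, hi⟩ := Set.mem_iUnion.1 (hcover hx)
    have h1 : φ i (-x) = 0 := le_antisymm
      (not_lt.1 fun h => hanti i x hi ((hφpos i _ (hneg x hx)).1 h)) (hφ0 i _)
    have h2 := congrFun h i
    have h3 := div_pos ((hφpos i x hx).2 hi) (hPpos x hx)
    simp only [h1, zero_div, sub_zero, Pi.zero_apply] at h2
    exact h3.ne' h2
  · intro i hi
    refine (hφpos i x hx).1 ((hφ0 i x).lt_of_ne fun h => ?_)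
    have h1 := div_nonneg (hφ0 i (-x)) (hPpos _ (hneg x hx)).le
    simp only [← h, zero_div] at hi
    linarith

/-- For `k ≥ 2`, the sphere `S^{2k-1}` (the unit sphere in `ℝ^{2k}`) cannot be
covered by `2k+1` open sets, none containing a pair of antipodal points, such that
every point of the sphere is contained in at most `k+1` of the sets. -/
theorem odd_sphere_no_small_cover (k : ℕ) (hk : 2 ≤ k) :
    ¬ ∃ U : Fin (2 * k + 1) → Set (EuclideanSpace ℝ (Fin (2 * k))),
      (∀ i, ∃ V, IsOpen V ∧ U i = V ∩ Metric.sphere 0 1) ∧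
      (Metric.sphere (0 : EuclideanSpace ℝ (Fin (2 * k))) 1 ⊆ ⋃ i, U i) ∧
      (∀ i, ∀ x, x ∈ U i → -x ∉ U i) ∧
      (∀ x ∈ Metric.sphere (0 : EuclideanSpace ℝ (Fin (2 * k))) 1,
        {i : Fin (2 * k + 1) | x ∈ U i}.ncard ≤ k + 1) := by
  rintro ⟨U, hopen, hcover, hanti, hmult⟩
  obtain ⟨g, hg, hodd, hprop⟩ := exists_odd_map_of_cover U hopen hcover hanti
  set last₁ : Fin (2 * k + 1) := ⟨k + 1, by omega⟩
  set last₂ : Fin (2 * k + 1) := ⟨2 * k, by omega⟩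
  obtain ⟨x, hx, hfx⟩ := exists_zero_of_odd_sphere (n := 2 * k - 1) (by omega)
    (fun x j => if j.val < k + 1 then g x ⟨j, by omega⟩ - g x last₁
      else g x ⟨j + 1, by omega⟩ - g x last₂)
    (by
      have hgi := continuousOn_pi.1 hg
      refine continuousOn_pi.2 fun j => ?_
      split_ifs
      · exact (hgi _).sub (hgi _)
      · exact (hgi _).sub (hgi _))
    (fun x _ => by
      ext j
      simp only [hodd, Pi.neg_apply]
      split_ifs <;> ring)
  obtain ⟨hsum, hne, hpos⟩ := hprop x hx
  have hfirst : ∀ i : Fin (2 * k + 1), i.val ≤ k + 1 → g x i = g x last₁ := by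
    intro i hi
    rcases hi.eq_or_lt with hi | hi
    · rw [show i = last₁ from Fin.ext hi]
    · have := congrFun hfx ⟨i, by omega⟩
      simpa [hi, sub_eq_zero] using this
  have hsecond : ∀ i : Fin (2 * k + 1), ¬ i.val ≤ k + 1 → g x i = g x last₂ := by
    intro i hi
    by_cases hi' : i.val = 2 * k
    · rw [show i = last₂ from Fin.ext hi']
    · have := congrFun hfx ⟨i - 1, by omega⟩
      have h1 : ¬ i.val - 1 < k + 1 := by omega
      have h2 : i.val - 1 + 1 = i.val := by omega
      simpa [h1, h2, sub_eq_zero] using this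
  set A : Finset (Fin (2 * k + 1)) := {i | i.val ≤ k + 1} with hA
  have hcardA : A.card = k + 2 := by
    have : A = Finset.Iic last₁ := by
      ext i
      simp [hA, Fin.le_def, last₁]
    rw [this, Fin.card_Iic]
  have hcard_lt : ∀ y ∈ Metric.sphere (0 : EuclideanSpace ℝ (Fin (2 * k))) 1,
      ¬ ∀ i ∈ A, y ∈ U i := by
    intro y hy h
    have h1 : (A : Set (Fin (2 * k + 1))) ⊆ {i | y ∈ U i} := h
    have h2 := Set.ncard_le_ncard h1 (Set.toFinite _)
    rw [Set.ncard_coe_finset, hcardA] at h2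
    have h3 := hmult y hy
    omega
  rcases lt_trichotomy (g x last₁) 0 with h | h | h
  · have hx' : -x ∈ Metric.sphere (0 : EuclideanSpace ℝ (Fin (2 * k))) 1 := by simpa using hx
    refine hcard_lt (-x) hx' fun i hi => (hprop _ hx').2.2 i ?_
    rw [hodd, Pi.neg_apply, hfirst i (by simpa [hA] using hi)]
    linarith
  · have hpart : ∑ i, g x i = ∑ i : Fin (2 * k + 1) with ¬ i.val ≤ k + 1, g x last₂ := by
      rw [Finset.sum_filter]
      refine Finset.sum_congr rfl fun i _ => ?_
      split_ifs with hi
      · rw [hfirst i hi, h]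
      · exact hsecond i hi
    have hcard : (Finset.univ.filter fun i : Fin (2 * k + 1) => ¬ i.val ≤ k + 1).card ≠ 0 :=
      Finset.card_ne_zero_of_mem (a := last₂) (by simp [last₂]; omega)
    rw [hsum, Finset.sum_const, nsmul_eq_mul, eq_comm, mul_eq_zero] at hpart
    have h2 : g x last₂ = 0 := hpart.resolve_left (by exact_mod_cast hcard)
    refine hne (funext fun i => ?_)
    by_cases hi : i.val ≤ k + 1
    · rw [hfirst i hi, h, Pi.zero_apply]
    · rw [hsecond i hi, h2, Pi.zero_apply]
  · refine hcard_lt x hx fun i hi => hpos i ?_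
    rw [hfirst i (by simpa [hA] using hi)]
    exact h
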